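/- For every graph cycle A ∈ C with |A| > 1, one has H_m(A) = max_A H − min_A H. -/

import Mathlib

open scoped ENNReal

namespace MetropolisCycles

variable {S : Type*} [Fintype S] [DecidableEq S]

/-- A path: a finite sequence of states whose consecutive members communicate. -/
def IsPath (q : S → S → ℝ) (ω : List S) : Prop :=
  ω.Chain' (fun a b => 0 < q a b)

/-- `x` and `y` are joined by a path entirely contained in `G`. -/
def JoinedIn (q : S → S → ℝ) (G : Set S) (x y : S) : Prop :=
  ∃ ω : List S, ω.head? = some x ∧ ω.getLast? = some y ∧ IsPath q ω ∧ ∀ z ∈ ω, z ∈ G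

/-- `G` is connected: any two of its points are joined by a path inside `G`. -/
def IsConnectedSet (q : S → S → ℝ) (G : Set S) : Prop :=
  ∀ x ∈ G, ∀ y ∈ G, JoinedIn q G x y

/-- The exterior boundary `∂G`. -/
def extBoundary (q : S → S → ℝ) (G : Set S) : Set S :=
  {y | y ∉ G ∧ ∃ x ∈ G, 0 < q x y}

/-- `A` is a non-trivial path cycle: connected and `max_A H < min_{∂A} H`. -/
def IsNontrivialPathCycle (H : S → ℝ) (q : S → S → ℝ) (A : Set S) : Prop :=
  A.Nonempty ∧ IsConnectedSet q A ∧ ∀ x ∈ A, ∀ y ∈ extBoundary q A, H x < H y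

/-- `A` is a path cycle: a singleton or a non-trivial path cycle. -/
def IsPathCycle (H : S → ℝ) (q : S → S → ℝ) (A : Set S) : Prop :=
  (∃ x, A = {x}) ∨ IsNontrivialPathCycle H q A

/-- The set of points joined to `x` by a path whose points all have energy at most `c`. -/
def energyCut (H : S → ℝ) (q : S → S → ℝ) (c : ℝ) (x : S) : Set S :=
  {y | JoinedIn q {z | H z ≤ c} x y}

/-- `U_{≤ x}`: the points joined to `x` by a path with energies at most `H x`. -/
def Ule (H : S → ℝ) (q : S → S → ℝ) (x : S) : Set S := energyCut H q (H x) x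

/-- The total cost of a path of cycles with respect to a cost function `Vs`. -/
noncomputable def listCost (Vs : Set S → Set S → ℝ≥0∞) : List (Set S) → ℝ≥0∞
  | [] => 0
  | [_] => 0
  | B :: B' :: l => Vs B B' + listCost Vs (B' :: l)

/-- `H_e` relative to a level `(E, V)` of the construction:
`H_e(A) = min { V(A,A') : A' ∈ E, A' ≠ A }`. -/
noncomputable def HeAux (E : Set (Set S)) (V : Set S → Set S → ℝ≥0∞) (A : Set S) : ℝ≥0∞ :=
  ⨅ A' ∈ E \ {A}, V A A'

/-- The renormalized cost function `V_* (A,B) = V(A,B) - H_e(A)`. -/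
noncomputable def VsAux (E : Set (Set S)) (V : Set S → Set S → ℝ≥0∞) (A B : Set S) : ℝ≥0∞ :=
  V A B - HeAux E V A

/-- `A →_k A'`: some path of elements of `E` from `A` to `A'` has zero total `V_*`-cost. -/
def arrowAux (E : Set (Set S)) (V : Set S → Set S → ℝ≥0∞) (A A' : Set S) : Prop :=
  ∃ l : List (Set S), l.head? = some A ∧ l.getLast? = some A' ∧ (∀ B ∈ l, B ∈ E) ∧
    listCost (VsAux E V) l = 0

/-- The set `D^{k+1}`: unions of the `R_k`-equivalence classes. -/
def DAux (E : Set (Set S)) (V : Set S → Set S → ℝ≥0∞) : Set (Set S) :=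
  {B | ∃ A ∈ E, B = ⋃₀ {A' | A' ∈ E ∧ arrowAux E V A A' ∧ arrowAux E V A' A}}

/-- The order relation `≥^{k+1}` on `D^{k+1}`. -/
def geqAux (E : Set (Set S)) (V : Set S → Set S → ℝ≥0∞) (B B' : Set S) : Prop :=
  ∃ C ∈ E, ∃ C' ∈ E, C ⊆ B ∧ C' ⊆ B' ∧ arrowAux E V C C'

/-- `D_*^{k+1}`: the minimal elements of `D^{k+1}` for `≥^{k+1}`. -/
def DstarAux (E : Set (Set S)) (V : Set S → Set S → ℝ≥0∞) : Set (Set S) :=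
  {B ∈ DAux E V | ∀ B' ∈ DAux E V, geqAux E V B B' → B' = B}

/-- `E^{k+1}` built from `(E^k, V^k)`. -/
def EnextAux (E : Set (Set S)) (V : Set S → Set S → ℝ≥0∞) : Set (Set S) :=
  DstarAux E V ∪ {A | A ∈ E ∧ ∃ B ∈ DAux E V \ DstarAux E V, A ⊆ B}

/-- `H_m^{k+1}(A) = max { H_e^k(A') : A' ∈ E^k, A' ⊆ A }`. -/
noncomputable def HmAux (E : Set (Set S)) (V : Set S → Set S → ℝ≥0∞) (A : Set S) : ℝ≥0∞ :=
  ⨆ A' ∈ {A' | A' ∈ E ∧ A' ⊆ A}, HeAux E V A'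

/-- `V^{k+1}(A,A') = H_m^{k+1}(A) + min { V_*^k(B,B') : B,B' ∈ E^k, B ⊆ A, B' ⊆ A' }`. -/
noncomputable def VnextAux (E : Set (Set S)) (V : Set S → Set S → ℝ≥0∞) (A A' : Set S) : ℝ≥0∞ :=
  HmAux E V A + ⨅ B ∈ {B | B ∈ E ∧ B ⊆ A}, ⨅ B' ∈ {B' | B' ∈ E ∧ B' ⊆ A'}, VsAux E V B B'

/-- The zero-order cost function `V^0({i},{j}) = (H j - H i)⁺` if `q i j > 0`, `∞` otherwise
(and `∞` on non-singletons). -/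
noncomputable def V0 (H : S → ℝ) (q : S → S → ℝ) (A B : Set S) : ℝ≥0∞ :=
  ⨅ i ∈ A, ⨅ j ∈ B, ⨅ _ : A = {i} ∧ B = {j} ∧ 0 < q i j, ENNReal.ofReal (H j - H i)

/-- The recursive construction `k ↦ (E^k, V^k)`. -/
noncomputable def cycEV (H : S → ℝ) (q : S → S → ℝ) : ℕ → Set (Set S) × (Set S → Set S → ℝ≥0∞)
  | 0 => ({A | ∃ i, A = {i}}, V0 H q)
  | k + 1 => (EnextAux (cycEV H q k).1 (cycEV H q k).2,
              VnextAux (cycEV H q k).1 (cycEV H q k).2)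

/-- The `k`-th order set of graph cycles `E^k`. -/
noncomputable def Ecyc (H : S → ℝ) (q : S → S → ℝ) (k : ℕ) : Set (Set S) := (cycEV H q k).1

/-- The `k`-th order cost function `V^k`. -/
noncomputable def Vcyc (H : S → ℝ) (q : S → S → ℝ) (k : ℕ) : Set S → Set S → ℝ≥0∞ :=
  (cycEV H q k).2

/-- `H_e^k(A)`. -/
noncomputable def Hek (H : S → ℝ) (q : S → S → ℝ) (k : ℕ) (A : Set S) : ℝ≥0∞ :=
  HeAux (Ecyc H q k) (Vcyc H q k) A

/-- `H_m^k(A)` (defined for `k ≥ 1`; set to `0` at `k = 0`). -/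
noncomputable def Hmk (H : S → ℝ) (q : S → S → ℝ) : ℕ → Set S → ℝ≥0∞
  | 0 => fun _ => 0
  | k + 1 => fun A => HmAux (Ecyc H q k) (Vcyc H q k) A

/-- `D^{n+1}` (indexed by `n`). -/
noncomputable def Dcyc (H : S → ℝ) (q : S → S → ℝ) (n : ℕ) : Set (Set S) :=
  DAux (Ecyc H q n) (Vcyc H q n)

/-- `D_*^{n+1}` (indexed by `n`). -/
noncomputable def DstarCyc (H : S → ℝ) (q : S → S → ℝ) (n : ℕ) : Set (Set S) :=
  DstarAux (Ecyc H q n) (Vcyc H q n)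

/-- The set of graph cycles `C = ∪_k E^k`. -/
def GraphCycles (H : S → ℝ) (q : S → S → ℝ) : Set (Set S) := {A | ∃ k, A ∈ Ecyc H q k}

/-- `H_e(A) = sup { H_e^k(A) : k ≥ 0, A ∈ E^k }` (for a graph cycle `A ≠ S`). -/
noncomputable def HeC (H : S → ℝ) (q : S → S → ℝ) (A : Set S) : ℝ≥0∞ :=
  ⨆ k, ⨆ _ : A ∈ Ecyc H q k, Hek H q k A

/-- `H_m(A) = max( sup { H_e(B) : B ∈ C, B ⊆ A, B ≠ A }, 0 )` (for `|A| > 1`). -/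
noncomputable def HmC (H : S → ℝ) (q : S → S → ℝ) (A : Set S) : ℝ≥0∞ :=
  ⨆ B ∈ {B | B ∈ GraphCycles H q ∧ B ⊆ A ∧ B ≠ A}, HeC H q B

section Levels

variable {α : Type*}

theorem exists_crossing {r : α → α → Prop} {p : α → Prop} {a b : α}
    (h : Relation.ReflTransGen r a b) (ha : p a) (hb : ¬ p b) :
    ∃ c d, Relation.ReflTransGen r a c ∧ r c d ∧ Relation.ReflTransGen r d b ∧ p c ∧ ¬ p d := by
  induction h using Relation.ReflTransGen.head_induction_on with
  | refl => exact absurd ha hb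
  | @head a c hac hcb ih =>
    by_cases hc : p c
    · obtain ⟨u, v, hu, huv, hv, hpu, hpv⟩ := ih hc
      exact ⟨u, v, hu.head hac, huv, hv, hpu, hpv⟩
    · exact ⟨a, c, .refl, hac, hcb, ha, hc⟩

theorem reflTransGen_of_isPath {q : α → α → ℝ} (l : List α) (x y : α) (hx : l.head? = some x)
    (hy : l.getLast? = some y) (hl : IsPath q l) :
    Relation.ReflTransGen (fun a b => 0 < q a b) x y := by
  induction l generalizing x with
  | nil => simp at hx
  | cons a l ih =>
    obtain rfl : a = x := by simpa using hx
    cases l with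
    | nil =>
      obtain rfl : a = y := by simpa using hy
      exact .refl
    | cons b l =>
      obtain ⟨hab, hbl⟩ := List.isChain_cons_cons.1 hl
      exact (ih b rfl (by simpa using hy) hbl).head hab

/-- `C` and `C'` are members of `E` and the step from `C` to `C'` has zero renormalized cost. -/
def FreeStep (E : Set (Set α)) (V : Set α → Set α → ℝ≥0∞) (C C' : Set α) : Prop :=
  C ∈ E ∧ C' ∈ E ∧ VsAux E V C C' = 0

theorem arrowAux_iff {E : Set (Set α)} {V : Set α → Set α → ℝ≥0∞} {A B : Set α} (hA : A ∈ E) :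
    arrowAux E V A B ↔ Relation.ReflTransGen (FreeStep E V) A B := by
  constructor
  · rintro ⟨l, hx, hy, hE, hc⟩
    clear hA
    induction l generalizing A with
    | nil => simp at hx
    | cons a l ih =>
      obtain rfl : a = A := by simpa using hx
      cases l with
      | nil =>
        obtain rfl : a = B := by simpa using hy
        exact .refl
      | cons b l =>
        simp only [listCost, add_eq_zero] at hc
        exact (ih rfl (by simpa using hy) (fun C hC => hE C (by simp [hC])) hc.2).head
          ⟨hE a (by simp), hE b (by simp), hc.1⟩
  · intro h
    induction h using Relation.ReflTransGen.head_induction_on with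
    | refl => exact ⟨[B], rfl, rfl, by simpa using hA, rfl⟩
    | @head a c hac hcb ih =>
      obtain ⟨l, hx, hy, hE, hc⟩ := ih hac.2.1
      cases l with
      | nil => simp at hx
      | cons b l =>
        obtain rfl : b = c := by simpa using hx
        refine ⟨a :: b :: l, rfl, by simpa using hy, ?_, ?_⟩
        · intro C hC
          rcases List.mem_cons.1 hC with rfl | hC
          · exact hA
          · exact hE C hC
        · simp [listCost, hac.2.2, hc]

/-- The lowest energy at which one can step from `A` to `B`. -/
noncomputable def barrier (h : α → ℝ≥0∞) (q : α → α → ℝ) (A B : Set α) : ℝ≥0∞ :=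
  ⨅ i ∈ A, ⨅ j ∈ B, ⨅ _ : 0 < q i j, max (h i) (h j)

/-- The minimal energy on `A`. -/
noncomputable def bottom (h : α → ℝ≥0∞) (A : Set α) : ℝ≥0∞ := ⨅ i ∈ A, h i

/-- Every proper nonempty part of `A` communicates with the rest of `A`. -/
def CutConnected (q : α → α → ℝ) (A : Set α) : Prop :=
  ∀ B ⊆ A, B.Nonempty → B ≠ A → ∃ i ∈ B, ∃ j ∈ A \ B, 0 < q i j

theorem barrier_le {h : α → ℝ≥0∞} {q : α → α → ℝ} {A B : Set α} {i j : α} (hi : i ∈ A) (hj : j ∈ B)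
    (hij : 0 < q i j) : barrier h q A B ≤ max (h i) (h j) :=
  iInf₂_le_of_le i hi (iInf₂_le_of_le j hj (iInf_le _ hij))

theorem le_barrier {h : α → ℝ≥0∞} {q : α → α → ℝ} {A B : Set α} {c : ℝ≥0∞}
    (hc : ∀ i ∈ A, ∀ j ∈ B, 0 < q i j → c ≤ max (h i) (h j)) : c ≤ barrier h q A B :=
  le_iInf₂ fun i hi => le_iInf₂ fun j hj => le_iInf fun hij => hc i hi j hj hij

theorem le_barrier_sub {h : α → ℝ≥0∞} {q : α → α → ℝ} {A B : Set α} {b c : ℝ≥0∞} (hc : c ≠ ⊤)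
    (hcAB : c ≤ barrier h q A B)
    (hb : ∀ i ∈ A, ∀ j ∈ B, 0 < q i j → b ≤ max (h i) (h j) - c) : b ≤ barrier h q A B - c := by
  refine ENNReal.le_sub_of_add_le_right hc (le_barrier fun i hi j hj hij => ?_)
  calc b + c ≤ max (h i) (h j) - c + c := by gcongr; exact hb i hi j hj hij
    _ = max (h i) (h j) := tsub_add_cancel_of_le (hcAB.trans (barrier_le hi hj hij))

theorem barrier_anti {h : α → ℝ≥0∞} {q : α → α → ℝ} {A A' B B' : Set α} (hA : A ⊆ A')
    (hB : B ⊆ B') : barrier h q A' B' ≤ barrier h q A B :=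
  le_barrier fun _ hi _ hj hij => barrier_le (hA hi) (hB hj) hij

theorem barrier_comm {h : α → ℝ≥0∞} {q : α → α → ℝ} (hsym : ∀ x y, q x y = q y x) (A B : Set α) :
    barrier h q A B = barrier h q B A := by
  apply le_antisymm <;>
  · refine le_barrier fun i hi j hj hij => ?_
    rw [max_comm]
    exact barrier_le hj hi (hsym i j ▸ hij)

theorem exists_edge_of_barrier_lt_top {h : α → ℝ≥0∞} {q : α → α → ℝ} {A B : Set α}
    (hAB : barrier h q A B < ⊤) : ∃ i ∈ A, ∃ j ∈ B, 0 < q i j := by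
  by_contra! hn
  exact hAB.not_ge (le_barrier fun i hi j hj hij => absurd hij (hn i hi j hj).not_gt)

theorem bottom_le {h : α → ℝ≥0∞} {A : Set α} {i : α} (hi : i ∈ A) : bottom h A ≤ h i :=
  iInf₂_le i hi

theorem bottom_le_barrier (h : α → ℝ≥0∞) (q : α → α → ℝ) (A B : Set α) :
    bottom h A ≤ barrier h q A B :=
  le_barrier fun _ hi _ _ _ => (bottom_le hi).trans (le_max_left _ _)

theorem bottom_anti {h : α → ℝ≥0∞} {A B : Set α} (hAB : A ⊆ B) : bottom h B ≤ bottom h A :=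
  le_iInf₂ fun _ hi => bottom_le (hAB hi)

theorem bottom_lt_top {h : α → ℝ≥0∞} (hh : ∀ x, h x < ⊤) {A : Set α} (hA : A.Nonempty) :
    bottom h A < ⊤ := by
  obtain ⟨x, hx⟩ := hA
  exact (bottom_le hx).trans_lt (hh x)

theorem barrier_compl_lt_top {h : α → ℝ≥0∞} {q : α → α → ℝ} (hh : ∀ x, h x < ⊤)
    (huniv : CutConnected q Set.univ) {A : Set α} (hA : A.Nonempty) (hA' : Aᶜ.Nonempty) :
    barrier h q A Aᶜ < ⊤ := by
  obtain ⟨i, hi, j, hj, hij⟩ :=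
    huniv A (Set.subset_univ _) hA (Set.nonempty_compl.1 hA')
  exact (barrier_le hi hj.2 hij).trans_lt (max_lt (hh i) (hh j))

/-- The invariants of a level `(E, V)` of the cycle decomposition. -/
structure IsLevel (h : α → ℝ≥0∞) (q : α → α → ℝ) (E : Set (Set α))
    (V : Set α → Set α → ℝ≥0∞) : Prop where
  finite : ∀ x, h x < ⊤
  nonempty : ∀ A ∈ E, A.Nonempty
  cover : ∀ x, ∃ A ∈ E, x ∈ A
  eq_of_mem : ∀ A ∈ E, ∀ B ∈ E, ∀ x, x ∈ A → x ∈ B → A = B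
  cost : ∀ A ∈ E, ∀ B ∈ E, A ≠ B → V A B = barrier h q A B - bottom h A
  connected : ∀ A ∈ E, CutConnected q A
  le_exit : ∀ A ∈ E, ∀ x ∈ A, h x ≤ barrier h q A Aᶜ

/-- The union of the class of `C` under mutual reachability. -/
def reachClass (E : Set (Set α)) (V : Set α → Set α → ℝ≥0∞) (C : Set α) : Set α :=
  ⋃₀ {A' | A' ∈ E ∧ arrowAux E V C A' ∧ arrowAux E V A' C}

/-- `A` is a union of mutually reachable members of `E`. -/
structure IsMerge (E : Set (Set α)) (V : Set α → Set α → ℝ≥0∞) (A : Set α) : Prop where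
  nonempty : A.Nonempty
  cover : ∀ x ∈ A, ∃ C ∈ E, x ∈ C ∧ C ⊆ A
  reach : ∀ C ∈ E, C ⊆ A → ∀ C' ∈ E, C' ⊆ A → Relation.ReflTransGen (FreeStep E V) C C'
  closed : ∀ C ∈ E, C ⊆ A → ∀ C' ∈ E, A ∉ E → Relation.ReflTransGen (FreeStep E V) C C' →
    Relation.ReflTransGen (FreeStep E V) C' C → C' ⊆ A

namespace IsLevel

variable {h : α → ℝ≥0∞} {q : α → α → ℝ} {E : Set (Set α)} {V : Set α → Set α → ℝ≥0∞}

theorem subset_compl (L : IsLevel h q E V) {A B : Set α} (hA : A ∈ E) (hB : B ∈ E)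
    (hAB : A ≠ B) : B ⊆ Aᶜ :=
  fun x hxB hxA => hAB (L.eq_of_mem A hA B hB x hxA hxB)

theorem heAux_eq (L : IsLevel h q E V) {A : Set α} (hA : A ∈ E) :
    HeAux E V A = barrier h q A Aᶜ - bottom h A := by
  apply le_antisymm
  · refine le_barrier_sub (bottom_lt_top L.finite (L.nonempty A hA)).ne
      (bottom_le_barrier h q A _) fun i hi j hj hij => ?_
    obtain ⟨B, hB, hjB⟩ := L.cover j
    have hne : A ≠ B := fun e => hj (e ▸ hjB)
    refine (iInf₂_le B ⟨hB, fun e => hne e.symm⟩).trans ?_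
    rw [L.cost A hA B hB hne]
    exact tsub_le_tsub_right (barrier_le hi hjB hij) _
  · refine le_iInf₂ fun B hB => ?_
    have hne : A ≠ B := fun e => hB.2 e.symm
    rw [L.cost A hA B hB.1 hne]
    exact tsub_le_tsub_right (barrier_anti subset_rfl (L.subset_compl hA hB.1 hne)) _

theorem vsAux_eq (L : IsLevel h q E V) {A B : Set α} (hA : A ∈ E) (hB : B ∈ E) (hAB : A ≠ B) :
    VsAux E V A B = barrier h q A B - barrier h q A Aᶜ := by
  rw [VsAux, L.heAux_eq hA, L.cost A hA B hB hAB, tsub_tsub,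
    add_tsub_cancel_of_le (bottom_le_barrier h q A _)]

theorem exit_le_of_reach (L : IsLevel h q E V) (hsym : ∀ x y, q x y = q y x) {A B : Set α}
    (hAB : Relation.ReflTransGen (FreeStep E V) A B) :
    barrier h q B Bᶜ ≤ barrier h q A Aᶜ := by
  induction hAB with
  | refl => exact le_rfl
  | @tail C D _ hCD ih =>
    refine le_trans ?_ ih
    obtain ⟨hC, hD, h0⟩ := hCD
    by_cases hne : C = D
    · rw [hne]
    rw [L.vsAux_eq hC hD hne, tsub_eq_zero_iff_le] at h0
    refine le_trans ?_ h0
    rw [barrier_comm hsym C D]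
    exact barrier_anti subset_rfl (L.subset_compl hD hC (Ne.symm hne))

theorem exit_eq (L : IsLevel h q E V) (hsym : ∀ x y, q x y = q y x) {A C C' : Set α}
    (M : IsMerge E V A) (hC : C ∈ E) (hCA : C ⊆ A) (hC' : C' ∈ E) (hCA' : C' ⊆ A) :
    barrier h q C Cᶜ = barrier h q C' C'ᶜ :=
  le_antisymm (L.exit_le_of_reach hsym (M.reach C' hC' hCA' C hC hCA))
    (L.exit_le_of_reach hsym (M.reach C hC hCA C' hC' hCA'))

theorem mem_reachClass (hC : C ∈ E) : C ⊆ reachClass E V C :=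
  Set.subset_sUnion_of_mem ⟨hC, (arrowAux_iff hC).2 .refl, (arrowAux_iff hC).2 .refl⟩

theorem reach_of_subset (L : IsLevel h q E V) {C C' : Set α} (hC : C ∈ E) (hC' : C' ∈ E)
    {x : α} (hx : x ∈ C') (hx' : x ∈ reachClass E V C) :
    Relation.ReflTransGen (FreeStep E V) C C' ∧ Relation.ReflTransGen (FreeStep E V) C' C := by
  obtain ⟨D, ⟨hD, h1, h2⟩, hxD⟩ := hx'
  obtain rfl := L.eq_of_mem _ hC' _ hD x hx hxD
  exact ⟨(arrowAux_iff hC).1 h1, (arrowAux_iff hD).1 h2⟩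

theorem reachClass_eq {C C' : Set α} (hC : C ∈ E) (hC' : C' ∈ E)
    (h1 : Relation.ReflTransGen (FreeStep E V) C C')
    (h2 : Relation.ReflTransGen (FreeStep E V) C' C) : reachClass E V C = reachClass E V C' := by
  unfold reachClass
  congr 1
  ext D
  simp only [Set.mem_ofPred_eq]
  refine and_congr_right fun hD => ?_
  rw [arrowAux_iff hC, arrowAux_iff hC', arrowAux_iff hD, arrowAux_iff hD]
  exact ⟨fun ⟨a, b⟩ => ⟨h2.trans a, b.trans h1⟩, fun ⟨a, b⟩ => ⟨h1.trans a, b.trans h2⟩⟩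

theorem mem_next_iff (L : IsLevel h q E V) {A : Set α} {x : α} {C : Set α} (hC : C ∈ E)
    (hxC : x ∈ C) (hx : x ∈ A) : A ∈ EnextAux E V ↔
      (reachClass E V C ∈ DstarAux E V ∧ A = reachClass E V C) ∨
      (reachClass E V C ∉ DstarAux E V ∧ A = C) := by
  have key : ∀ B ∈ DAux E V, x ∈ B → B = reachClass E V C := by
    rintro B ⟨C', hC', rfl⟩ hxB
    obtain ⟨h1, h2⟩ := L.reach_of_subset hC' hC hxC hxB
    exact reachClass_eq hC' hC h1 h2
  constructor
  · rintro (hA | ⟨hA, B, ⟨hB, hB'⟩, hAB⟩)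
    · have := key A hA.1 hx
      exact Or.inl ⟨this ▸ hA, this⟩
    · have := key B hB (hAB hx)
      exact Or.inr ⟨this ▸ hB', L.eq_of_mem A hA C hC x hx hxC⟩
  · rintro (⟨h1, rfl⟩ | ⟨h1, rfl⟩)
    · exact Or.inl h1
    · exact Or.inr ⟨hC, _, ⟨⟨A, hC, rfl⟩, h1⟩, mem_reachClass hC⟩

theorem next_nonempty (L : IsLevel h q E V) {A : Set α} (hA : A ∈ EnextAux E V) :
    A.Nonempty := by
  rcases hA with hA | hA
  · obtain ⟨C, hC, rfl⟩ := hA.1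
    exact (L.nonempty C hC).mono (mem_reachClass hC)
  · exact L.nonempty A hA.1

theorem isMerge (L : IsLevel h q E V) {A : Set α} (hA : A ∈ EnextAux E V) : IsMerge E V A := by
  obtain ⟨x, hx⟩ := L.next_nonempty hA
  obtain ⟨C, hC, hxC⟩ := L.cover x
  rcases (L.mem_next_iff hC hxC hx).1 hA with ⟨-, rfl⟩ | ⟨-, rfl⟩
  · have hr : ∀ D ∈ E, D ⊆ reachClass E V C → Relation.ReflTransGen (FreeStep E V) C D ∧
        Relation.ReflTransGen (FreeStep E V) D C := by
      intro D hD hDC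
      obtain ⟨y, hy⟩ := L.nonempty D hD
      exact L.reach_of_subset hC hD hy (hDC hy)
    refine ⟨⟨x, hx⟩, ?_, ?_, ?_⟩
    · rintro y ⟨D, hD, hy⟩
      exact ⟨D, hD.1, hy, Set.subset_sUnion_of_mem hD⟩
    · intro D hD hDC D' hD' hDC'
      exact (hr D hD hDC).2.trans (hr D' hD' hDC').1
    · intro D hD hDC D' hD' _ h1 h2
      have := hr D hD hDC
      rw [reachClass_eq hC hD this.1 this.2, reachClass_eq hD hD' h1 h2]
      exact mem_reachClass hD'
  · refine ⟨⟨x, hx⟩, fun y hy => ⟨A, hC, hy, subset_rfl⟩, ?_, fun _ _ _ _ _ h => absurd hC h⟩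
    have he : ∀ D ∈ E, D ⊆ A → D = A := by
      intro D hD hDA
      obtain ⟨y, hy⟩ := L.nonempty D hD
      exact L.eq_of_mem D hD A hC y hy (hDA hy)
    intro D hD hDA D' hD' hDA'
    rw [he D hD hDA, he D' hD' hDA']

theorem exit_le_barrier (L : IsLevel h q E V) (hsym : ∀ x y, q x y = q y x) {A C B : Set α}
    (M : IsMerge E V A) (hC : C ∈ E) (hCA : C ⊆ A) (hB : B ⊆ Aᶜ) :
    barrier h q C Cᶜ ≤ barrier h q A B := by
  refine le_barrier fun i hi j hj hij => ?_
  obtain ⟨D, hD, hiD, hDA⟩ := M.cover i hi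
  rw [L.exit_eq hsym M hC hCA hD hDA]
  exact barrier_le hiD (fun hjD => hB hj (hDA hjD)) hij

theorem hmAux_eq (L : IsLevel h q E V) (hsym : ∀ x y, q x y = q y x) {A C : Set α}
    (M : IsMerge E V A) (hC : C ∈ E) (hCA : C ⊆ A) :
    HmAux E V A = barrier h q C Cᶜ - bottom h A := by
  apply le_antisymm
  · refine iSup₂_le fun D hD => ?_
    rw [L.heAux_eq hD.1, L.exit_eq hsym M hC hCA hD.1 hD.2]
    exact tsub_le_tsub_left (bottom_anti hD.2) _
  · simp only [bottom, ENNReal.sub_iInf]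
    refine iSup₂_le fun i hi => ?_
    obtain ⟨D, hD, hiD, hDA⟩ := M.cover i hi
    refine le_trans ?_ (le_iSup₂ (f := fun A' (_ : A' ∈ {A' | A' ∈ E ∧ A' ⊆ A}) => HeAux E V A')
      D ⟨hD, hDA⟩)
    rw [L.heAux_eq hD, L.exit_eq hsym M hC hCA hD hDA]
    exact tsub_le_tsub_left (bottom_le hiD) _

theorem vnextAux_eq (L : IsLevel h q E V) (hsym : ∀ x y, q x y = q y x)
    (huniv : CutConnected q Set.univ) {A B : Set α}
    (MA : IsMerge E V A) (MB : IsMerge E V B) (hAB : B ⊆ Aᶜ) :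
    VnextAux E V A B = barrier h q A B - bottom h A := by
  obtain ⟨x, hx⟩ := MA.nonempty
  obtain ⟨C, hC, -, hCA⟩ := MA.cover x hx
  have hv : ∀ D ∈ E, D ⊆ A → ∀ D' ∈ E, D' ⊆ B →
      VsAux E V D D' = barrier h q D D' - barrier h q C Cᶜ := by
    intro D hD hDA D' hD' hDB
    rw [L.exit_eq hsym MA hC hCA hD hDA]
    refine L.vsAux_eq hD hD' ?_
    rintro rfl
    obtain ⟨y, hy⟩ := L.nonempty D hD
    exact hAB (hDB hy) (hDA hy)
  have hinf : (⨅ D ∈ {D | D ∈ E ∧ D ⊆ A}, ⨅ D' ∈ {D' | D' ∈ E ∧ D' ⊆ B}, VsAux E V D D') =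
      barrier h q A B - barrier h q C Cᶜ := by
    apply le_antisymm
    · obtain ⟨y, hy⟩ := MB.nonempty
      refine le_barrier_sub (barrier_compl_lt_top L.finite huniv (L.nonempty C hC)
        ⟨y, fun hyC => hAB hy (hCA hyC)⟩).ne (L.exit_le_barrier hsym MA hC hCA hAB)
        fun i hi j hj hij => ?_
      obtain ⟨D, hD, hiD, hDA⟩ := MA.cover i hi
      obtain ⟨D', hD', hjD, hDB⟩ := MB.cover j hj
      refine (iInf₂_le_of_le D ⟨hD, hDA⟩ (iInf₂_le D' ⟨hD', hDB⟩)).trans ?_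
      rw [hv D hD hDA D' hD' hDB]
      exact tsub_le_tsub_right (barrier_le hiD hjD hij) _
    · refine le_iInf₂ fun D hD => le_iInf₂ fun D' hD' => ?_
      rw [hv D hD.1 hD.2 D' hD'.1 hD'.2]
      exact tsub_le_tsub_right (barrier_anti hD.2 hD'.2) _
  rw [VnextAux, hinf, L.hmAux_eq hsym MA hC hCA, add_comm]
  exact tsub_add_tsub_cancel (L.exit_le_barrier hsym MA hC hCA hAB)
    ((bottom_anti hCA).trans (bottom_le_barrier h q C _))

theorem cutConnected_merge (L : IsLevel h q E V)
    (huniv : CutConnected q Set.univ) {A : Set α} (M : IsMerge E V A)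
    (hcl : A ∉ E) : CutConnected q A := by
  intro B hBA ⟨x, hx⟩ hne
  obtain ⟨y, hyA, hyB⟩ : ∃ y ∈ A, y ∉ B := by
    by_contra! hn
    exact hne (hBA.antisymm hn)
  obtain ⟨C, hC, hxC, hCA⟩ := M.cover x (hBA hx)
  obtain ⟨D, hD, hyD, hDA⟩ := M.cover y hyA
  have split : ∀ F ∈ E, F ⊆ A → (F ∩ B).Nonempty → ¬ F ⊆ B →
      ∃ i ∈ B, ∃ j ∈ A \ B, 0 < q i j := by
    intro F hF hFA hFB hFB'
    obtain ⟨i, hi, j, hj, hij⟩ := L.connected F hF (F ∩ B) Set.inter_subset_left hFB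
      (fun e => hFB' (Set.inter_eq_left.1 e))
    exact ⟨i, hi.2, j, ⟨hFA hj.1, fun hjB => hj.2 ⟨hj.1, hjB⟩⟩, hij⟩
  by_cases hCB : C ⊆ B
  · obtain ⟨F, G, hCF, ⟨hF, hG, h0⟩, hGD, hFB, hGB⟩ :=
      exists_crossing (p := fun F => F ⊆ B) (M.reach C hC hCA D hD hDA) hCB
        (fun hDB => hyB (hDB hyD))
    have hDC := M.reach D hD hDA C hC hCA
    have hFG : Relation.ReflTransGen (FreeStep E V) F G := .single ⟨hF, hG, h0⟩
    have hGA : G ⊆ A := M.closed C hC hCA G hG hcl (hCF.trans hFG) (hGD.trans hDC)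
    by_cases hGi : (G ∩ B).Nonempty
    · exact split G hG hGA hGi hGB
    have hFG' : F ≠ G := fun e => hGB (e ▸ hFB)
    rw [L.vsAux_eq hF hG hFG', tsub_eq_zero_iff_le] at h0
    obtain ⟨g, hg⟩ := L.nonempty G hG
    obtain ⟨i, hi, j, hj, hij⟩ := exists_edge_of_barrier_lt_top
      (h0.trans_lt (barrier_compl_lt_top L.finite huniv (L.nonempty F hF)
        ⟨g, L.subset_compl hF hG hFG' hg⟩))
    exact ⟨i, hFB hi, j, ⟨hGA hj, fun hjB => hGi ⟨j, hj, hjB⟩⟩, hij⟩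
  · exact split C hC hCA ⟨x, hxC, hx⟩ hCB

theorem next (L : IsLevel h q E V) (hsym : ∀ x y, q x y = q y x)
    (huniv : CutConnected q Set.univ) : IsLevel h q (EnextAux E V) (VnextAux E V) := by
  have heq : ∀ A ∈ EnextAux E V, ∀ B ∈ EnextAux E V, ∀ x, x ∈ A → x ∈ B → A = B := by
    intro A hA B hB x hxA hxB
    obtain ⟨C, hC, hxC⟩ := L.cover x
    rw [L.mem_next_iff hC hxC hxA] at hA
    rw [L.mem_next_iff hC hxC hxB] at hB
    rcases hA with ⟨h1, rfl⟩ | ⟨h1, rfl⟩ <;> rcases hB with ⟨h2, rfl⟩ | ⟨h2, rfl⟩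
    · rfl
    · exact absurd h1 h2
    · exact absurd h2 h1
    · rfl
  refine ⟨L.finite, fun A hA => L.next_nonempty hA, ?_, heq, ?_, ?_, ?_⟩
  · intro x
    obtain ⟨C, hC, hxC⟩ := L.cover x
    by_cases hD : reachClass E V C ∈ DstarAux E V
    · exact ⟨_, (L.mem_next_iff hC hxC (mem_reachClass hC hxC)).2 (Or.inl ⟨hD, rfl⟩),
        mem_reachClass hC hxC⟩
    · exact ⟨C, (L.mem_next_iff hC hxC hxC).2 (Or.inr ⟨hD, rfl⟩), hxC⟩
  · intro A hA B hB hAB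
    exact L.vnextAux_eq hsym huniv (L.isMerge hA) (L.isMerge hB)
      fun x hxB hxA => hAB (heq A hA B hB x hxA hxB)
  · intro A hA
    by_cases hAE : A ∈ E
    · exact L.connected A hAE
    · exact L.cutConnected_merge huniv (L.isMerge hA) hAE
  · intro A hA x hx
    obtain ⟨C, hC, hxC, hCA⟩ := (L.isMerge hA).cover x hx
    exact (L.le_exit C hC x hxC).trans
      (L.exit_le_barrier hsym (L.isMerge hA) hC hCA subset_rfl)

theorem exists_sub_le_heAux (L : IsLevel h q E V) (hsym : ∀ x y, q x y = q y x) {A : Set α}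
    (hA : A ∈ EnextAux E V) (hAE : A ∉ E) {x y : α} (hx : x ∈ A) (hy : y ∈ A) :
    ∃ C ∈ E, C ⊆ A ∧ C ≠ A ∧ h x - h y ≤ HeAux E V C := by
  obtain ⟨C, hC, hyC, hCA⟩ := (L.isMerge hA).cover y hy
  obtain ⟨D, hD, hxD, hDA⟩ := (L.isMerge hA).cover x hx
  refine ⟨C, hC, hCA, fun e => hAE (e ▸ hC), ?_⟩
  rw [L.heAux_eq hC, L.exit_eq hsym (L.isMerge hA) hC hCA hD hDA]
  exact tsub_le_tsub (L.le_exit D hD x hxD) (bottom_le hyC)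

end IsLevel

theorem cutConnected_univ {q : α → α → ℝ} (hirr : ∀ x y : α, JoinedIn q Set.univ x y) :
    CutConnected q Set.univ := by
  intro B _ ⟨x, hx⟩ hB
  obtain ⟨y, hy⟩ := (Set.ne_univ_iff_exists_notMem B).1 hB
  obtain ⟨l, h1, h2, h3, -⟩ := hirr x y
  obtain ⟨c, d, -, hcd, -, hc, hd⟩ :=
    exists_crossing (p := (· ∈ B)) (reflTransGen_of_isPath l x y h1 h2 h3) hx hy
  exact ⟨c, hc, d, ⟨trivial, hd⟩, hcd⟩

theorem isLevel_zero (H : α → ℝ) (q : α → α → ℝ) {c : ℝ} (hc : ∀ x, c ≤ H x) :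
    IsLevel (fun x => ENNReal.ofReal (H x - c)) q {A | ∃ i, A = {i}} (V0 H q) where
  finite _ := ENNReal.ofReal_lt_top
  nonempty := by rintro _ ⟨i, rfl⟩; exact ⟨i, rfl⟩
  cover x := ⟨{x}, ⟨x, rfl⟩, rfl⟩
  eq_of_mem := by
    rintro _ ⟨i, rfl⟩ _ ⟨j, rfl⟩ x rfl h
    rw [Set.mem_singleton_iff.1 h]
  cost := by
    rintro _ ⟨i, rfl⟩ _ ⟨j, rfl⟩ -
    by_cases hij : 0 < q i j
    · have hmax : max (ENNReal.ofReal (H i - c)) (ENNReal.ofReal (H j - c)) -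
          ENNReal.ofReal (H i - c) = ENNReal.ofReal (H j - c) - ENNReal.ofReal (H i - c) := by
        rcases le_total (ENNReal.ofReal (H i - c)) (ENNReal.ofReal (H j - c)) with h | h
        · rw [max_eq_right h]
        · rw [max_eq_left h, tsub_self, tsub_eq_zero_of_le h]
      simp only [V0, barrier, bottom, Set.mem_singleton_iff, iInf_iInf_eq_left, hij, and_self,
        iInf_pos, hmax]
      rw [← ENNReal.ofReal_sub _ (sub_nonneg.2 (hc i)), sub_sub_sub_cancel_right]
    · simp [V0, barrier, bottom, hij]
  connected := by
    rintro _ ⟨i, rfl⟩ B hB hne hne'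
    rcases Set.subset_singleton_iff_eq.1 hB with rfl | rfl
    · simp at hne
    · exact absurd rfl hne'
  le_exit := by
    rintro _ ⟨i, rfl⟩ x rfl
    refine le_barrier fun j hj _ _ _ => ?_
    rw [Set.mem_singleton_iff.1 hj]
    exact le_max_left _ _

theorem isLevel_cyc {H : α → ℝ} {q : α → α → ℝ} {c : ℝ} (hc : ∀ x, c ≤ H x)
    (hsym : ∀ x y : α, q x y = q y x) (hirr : ∀ x y : α, JoinedIn q Set.univ x y) (k : ℕ) :
    IsLevel (fun x => ENNReal.ofReal (H x - c)) q (Ecyc H q k) (Vcyc H q k) := by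
  induction k with
  | zero => exact isLevel_zero H q hc
  | succ k ih => exact ih.next hsym (cutConnected_univ hirr)

theorem sub_le_HmC {H : α → ℝ} {q : α → α → ℝ} {c : ℝ} (hc : ∀ x, c ≤ H x)
    (hsym : ∀ x y : α, q x y = q y x) (hirr : ∀ x y : α, JoinedIn q Set.univ x y) {A : Set α}
    {k : ℕ} (hA : A ∈ Ecyc H q k) {x y : α} (hx : x ∈ A) (hy : y ∈ A) :
    ENNReal.ofReal (H x - c) - ENNReal.ofReal (H y - c) ≤ HmC H q A := by
  induction k with
  | zero =>
    obtain ⟨i, rfl⟩ := hA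
    rw [Set.mem_singleton_iff.1 hx, Set.mem_singleton_iff.1 hy, tsub_self]
    exact zero_le
  | succ k ih =>
    by_cases hAk : A ∈ Ecyc H q k
    · exact ih hAk
    obtain ⟨C, hC, hCA, hne, hle⟩ :=
      (isLevel_cyc hc hsym hirr k).exists_sub_le_heAux hsym hA hAk hx hy
    refine hle.trans (le_trans ?_
      (le_iSup₂ (f := fun B (_ : B ∈ {B | B ∈ GraphCycles H q ∧ B ⊆ A ∧ B ≠ A}) => HeC H q B)
        C ⟨⟨k, hC⟩, hCA, hne⟩))
    exact le_iSup₂ (f := fun k (_ : C ∈ Ecyc H q k) => Hek H q k C) k hC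

end Levels

/-- For every graph cycle `A` with `|A| > 1`, `H_m(A) = max_A H - min_A H`. -/
theorem HmC_eq (H : S → ℝ) (q : S → S → ℝ)
    (hq : ∀ x y : S, 0 ≤ q x y ∧ q x y ≤ 1)
    (hsum : ∀ x : S, ∑ y ∈ Finset.univ.erase x, q x y ≤ 1)
    (hsym : ∀ x y : S, q x y = q y x)
    (hirr : ∀ x y : S, JoinedIn q Set.univ x y)
    (A : Set S) (hA : A ∈ GraphCycles H q) (hcard : 1 < A.ncard) :
    HmC H q A = ENNReal.ofReal (sSup (H '' A) - sInf (H '' A)) := by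
  obtain ⟨k, hk⟩ := hA
  have hne : A.Nonempty := Set.nonempty_of_ncard_ne_zero (by omega)
  obtain ⟨z, -⟩ := id hne
  obtain ⟨b, hb⟩ : ∃ b, ∀ x, H b ≤ H x :=
    haveI : Nonempty S := ⟨z⟩
    Finite.exists_min H
  have hfin : (H '' A).Finite := Set.toFinite _
  obtain ⟨x, hx, hxs⟩ := (hne.image H).csSup_mem hfin
  obtain ⟨y, hy, hys⟩ := (hne.image H).csInf_mem hfin
  have hdiff : ENNReal.ofReal (sSup (H '' A) - sInf (H '' A)) =
      ENNReal.ofReal (H x - H b) - ENNReal.ofReal (H y - H b) := by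
    rw [← ENNReal.ofReal_sub _ (sub_nonneg.2 (hb y)), sub_sub_sub_cancel_right, hxs, hys]
  have hmax : ∀ w ∈ A, ENNReal.ofReal (H w - H b) ≤ ENNReal.ofReal (H x - H b) := fun w hw =>
    ENNReal.ofReal_le_ofReal (sub_le_sub_right
      (hxs ▸ le_csSup hfin.bddAbove (Set.mem_image_of_mem H hw)) _)
  have hmin : ∀ w ∈ A, ENNReal.ofReal (H y - H b) ≤ ENNReal.ofReal (H w - H b) := fun w hw =>
    ENNReal.ofReal_le_ofReal (sub_le_sub_right
      (hys ▸ csInf_le hfin.bddBelow (Set.mem_image_of_mem H hw)) _)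
  rw [hdiff]
  refine le_antisymm ?_ (sub_le_HmC hb hsym hirr hk hx hy)
  refine iSup₂_le fun B hB => iSup₂_le fun n hn => ?_
  obtain ⟨-, hBA, hBne⟩ := hB
  have L := isLevel_cyc hb hsym hirr n
  obtain ⟨i, hi, j, hj, hij⟩ :=
    (isLevel_cyc hb hsym hirr k).connected A hk B hBA (L.nonempty B hn) hBne
  rw [Hek, L.heAux_eq hn]
  exact tsub_le_tsub ((barrier_le hi hj.2 hij).trans (max_le (hmax i (hBA hi)) (hmax j hj.1)))
    (le_iInf₂ fun w hw => hmin w (hBA hw))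

end MetropolisCycles
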